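/- arXiv:2312.15294 — 2 statements merged into one kernel-verified Lean document; each statement's English description precedes it below -/
import Mathlib

section
/- Let ρ be a real-valued radial neutral Schwartz function on ℝ², let m > 0, I > 0. Then the momentum map F(v,ω) = (P(v,ω), M(v,ω)) defined on Σ = {(v,ω) ∈ ℝ² × ℝ : |v| < 1} by the explicit Fourier integral formulas (with D_v(k) = |k|² − (v·k)²): P_j(v,ω) = m v_j + v_j ∫ |ρ̂|²/D_v − ∫ (v·k)k_j |ρ̂|²/(|k|² D_v) + ∫ (|v|² − (v·k)²/|k|²)(v·k)k_j |ρ̂|²/D_v² + ω² ∫ (v·k)k_j |∇ρ̂|²/D_v² and M(v,ω) = ω( I + ∫ |∇ρ̂|²/D_v ), is injective: distinct parameters (v,ω) ≠ (v',ω') in Σ have distinct momenta (P,M). (Uniqueness of the soliton with given total linear and angular momenta.) -/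
open MeasureTheory
open scoped RealInnerProductSpace BigOperators

noncomputable section

abbrev V2 : Type := EuclideanSpace ℝ (Fin 2)

/-- standard basis vector of ℝ² -/
def e2 (j : Fin 2) : V2 := EuclideanSpace.single j 1

/-- Fourier transform with normalization `(2π)⁻¹ ∫ e^{-ik·x} ρ(x) dx`. -/
def FT (ρ : V2 → ℝ) (k : V2) : ℂ :=
  ((2 * Real.pi : ℝ) : ℂ)⁻¹ * ∫ x : V2, Complex.exp (-Complex.I * ((⟪k, x⟫ : ℝ) : ℂ)) * (ρ x : ℂ)

/-- j-th partial derivative of a complex-valued function on ℝ². -/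
def pd (f : V2 → ℂ) (j : Fin 2) (k : V2) : ℂ := fderiv ℝ f k (e2 j)

/-- `|∇f(k)|²` for a complex-valued function on ℝ². -/
def gradNormSqC (f : V2 → ℂ) (k : V2) : ℝ := ∑ j, ‖pd f j k‖ ^ 2

/-- `D(k) = |k|² - (v·k)²`. -/
def Dv (v : V2) (k : V2) : ℝ := ‖k‖ ^ 2 - (⟪v, k⟫ : ℝ) ^ 2

/-- `(J ∇f)_j` where `J` has rows `(0,1)`, `(-1,0)`. -/
def Jgrad (f : V2 → ℂ) (j : Fin 2) (k : V2) : ℂ := ![pd f 1 k, -pd f 0 k] j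

/-- Fourier transform of the soliton field `A_{v,ω}`. -/
def Ahat (ρ : V2 → ℝ) (v : V2) (ω : ℝ) (j : Fin 2) (k : V2) : ℂ :=
  (((v j - k j * (⟪v, k⟫ : ℝ) / ‖k‖ ^ 2 : ℝ) : ℂ) * FT ρ k
      - Complex.I * (ω : ℂ) * Jgrad (FT ρ) j k) / ((Dv v k : ℝ) : ℂ)

/-- The soliton field `A_{v,ω}` (inverse Fourier transform of `Ahat`). -/
def Asol (ρ : V2 → ℝ) (v : V2) (ω : ℝ) (j : Fin 2) (y : V2) : ℝ :=
  (((2 * Real.pi : ℝ) : ℂ)⁻¹ *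
    ∫ k : V2, Complex.exp (Complex.I * ((⟪k, y⟫ : ℝ) : ℂ)) * Ahat ρ v ω j k).re

/-- The soliton field `Π_{v,ω} = -(v·∇) A_{v,ω}`. -/
def Pisol (ρ : V2 → ℝ) (v : V2) (ω : ℝ) (j : Fin 2) (y : V2) : ℝ :=
  - fderiv ℝ (Asol ρ v ω j) y v

/-- `|∇A(y)|² = ∑_{i,j} (∂_i A_j(y))²`. -/
def gradSq (A : Fin 2 → V2 → ℝ) (y : V2) : ℝ :=
  ∑ i, ∑ j, (fderiv ℝ (A j) y (e2 i)) ^ 2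

/-- Field energy `½∫ (|Π|² + |∇A|²)`. -/
def fieldEnergy (A Pf : Fin 2 → V2 → ℝ) : ℝ :=
  (1 / 2) * ∫ y : V2, ((∑ j, (Pf j y) ^ 2) + gradSq A y)

/-- `⟨Π, ∇_* A⟩_j = ∫ Π(y)·∂_j A(y) dy`. -/
def momTerm (A Pf : Fin 2 → V2 → ℝ) (j : Fin 2) : ℝ :=
  ∫ y : V2, ∑ l, Pf l y * fderiv ℝ (A l) y (e2 j)

/-- `⟨A, ρ⟩_j = ∫ A_j(y) ρ(y) dy`. -/
def chargeTerm (ρ : V2 → ℝ) (A : Fin 2 → V2 → ℝ) (j : Fin 2) : ℝ :=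
  ∫ y : V2, A j y * ρ y

/-- `∫ (Jy)·A(y) ρ(y) dy` where `(Jy) = (y₂, -y₁)`. -/
def angTerm (ρ : V2 → ℝ) (A : Fin 2 → V2 → ℝ) : ℝ :=
  ∫ y : V2, (y 1 * A 0 y - y 0 * A 1 y) * ρ y

/-- The reduced Hamiltonian `H_{P,M}(A,Π)`. -/
def Hred (m I : ℝ) (ρ : V2 → ℝ) (P : Fin 2 → ℝ) (M : ℝ) (A Pf : Fin 2 → V2 → ℝ) : ℝ :=
  fieldEnergy A Pf
    + (1 / (2 * m)) * ∑ j, (P j + momTerm A Pf j - chargeTerm ρ A j) ^ 2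
    + (1 / (2 * I)) * (M + angTerm ρ A) ^ 2

/-- The soliton linear momentum `P_{v,ω}`. -/
def Psol (ρ : V2 → ℝ) (m : ℝ) (v : V2) (ω : ℝ) (j : Fin 2) : ℝ :=
  m * v j - momTerm (Asol ρ v ω) (Pisol ρ v ω) j + chargeTerm ρ (Asol ρ v ω) j

/-- The soliton angular momentum `M_{v,ω}`. -/
def Msol (ρ : V2 → ℝ) (I : ℝ) (v : V2) (ω : ℝ) : ℝ :=
  I * ω - angTerm ρ (Asol ρ v ω)

/-- The soliton total linear momentum `P(v,ω)`, via its Fourier integral formula. -/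
def Pform (ρ : V2 → ℝ) (m : ℝ) (v : V2) (ω : ℝ) (j : Fin 2) : ℝ :=
  m * v j
    + v j * (∫ k : V2, ‖FT ρ k‖ ^ 2 / Dv v k)
    - (∫ k : V2, (⟪v, k⟫ : ℝ) * k j * ‖FT ρ k‖ ^ 2 / (‖k‖ ^ 2 * Dv v k))
    + (∫ k : V2, (‖v‖ ^ 2 - (⟪v, k⟫ : ℝ) ^ 2 / ‖k‖ ^ 2) * (⟪v, k⟫ : ℝ) * k j
        * ‖FT ρ k‖ ^ 2 / (Dv v k) ^ 2)
    + ω ^ 2 * (∫ k : V2, (⟪v, k⟫ : ℝ) * k j * gradNormSqC (FT ρ) k / (Dv v k) ^ 2)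

/-- The soliton total angular momentum `M(v,ω)`, via its Fourier integral formula. -/
def Mform (ρ : V2 → ℝ) (I : ℝ) (v : V2) (ω : ℝ) : ℝ :=
  ω * (I + ∫ k : V2, gradNormSqC (FT ρ) k / Dv v k)

/-- The momentum map `F(v,ω) = (P(v,ω), M(v,ω))`. -/
def Fmap (ρ : V2 → ℝ) (m I : ℝ) (p : V2 × ℝ) : V2 × ℝ :=
  ((WithLp.equiv 2 (Fin 2 → ℝ)).symm (fun j => Pform ρ m p.1 p.2 j), Mform ρ I p.1 p.2)

/-- The point of the unit circle at angle `θ`. -/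
def unitVec (θ : ℝ) : V2 := !₂[Real.cos θ, Real.sin θ]

@[simp] lemma unitVec_zero_apply (θ : ℝ) : unitVec θ 0 = Real.cos θ := rfl

@[simp] lemma unitVec_one_apply (θ : ℝ) : unitVec θ 1 = Real.sin θ := rfl

lemma norm_unitVec (θ : ℝ) : ‖unitVec θ‖ = 1 := by
  simp [EuclideanSpace.norm_eq, unitVec]

lemma inner_unitVec (α θ : ℝ) : (⟪unitVec α, unitVec θ⟫ : ℝ) = Real.cos (θ - α) := by
  simp [PiLp.inner_apply, Fin.sum_univ_two, Real.cos_sub]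

lemma exists_polar (v : V2) : ∃ s α : ℝ, 0 ≤ s ∧ s = ‖v‖ ∧ v = s • unitVec α := by
  have hn : ‖(v 0 + v 1 * Complex.I : ℂ)‖ = ‖v‖ :=
    Complex.orthonormalBasisOneI.repr.symm.norm_map v
  have h := Complex.norm_mul_cos_add_sin_mul_I (v 0 + v 1 * Complex.I : ℂ)
  rw [hn] at h
  refine ⟨‖v‖, Complex.arg (v 0 + v 1 * Complex.I : ℂ), norm_nonneg _, rfl, ?_⟩
  have h0 := congrArg Complex.re h
  have h1 := congrArg Complex.im h
  ext j
  fin_cases j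
  · simpa [-Complex.norm_mul_cos_add_sin_mul_I, Complex.cos_ofReal_re] using h0.symm
  · simpa [-Complex.norm_mul_cos_add_sin_mul_I, Complex.sin_ofReal_re] using h1.symm

/-- The rotation of the plane by the angle `θ`. -/
def rot (θ : ℝ) : V2 ≃ₗᵢ[ℝ] V2 :=
  (Complex.orthonormalBasisOneI.repr.symm.trans (rotation (Circle.exp θ))).trans
    Complex.orthonormalBasisOneI.repr

lemma rot_unitVec (θ φ : ℝ) : rot θ (unitVec φ) = unitVec (θ + φ) := by
  ext j
  fin_cases j <;>
    simp [rot, rotation_apply, Circle.coe_exp, Complex.exp_mul_I, Real.cos_add, Real.sin_add,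
      ← Complex.ofReal_cos, ← Complex.ofReal_sin]
  ring

lemma rot_e2_zero (θ : ℝ) : rot θ (e2 0) = Real.cos θ • e2 0 + Real.sin θ • e2 1 := by
  ext j
  fin_cases j <;>
    simp [rot, rotation_apply, Circle.coe_exp, Complex.exp_mul_I, e2,
      ← Complex.ofReal_cos, ← Complex.ofReal_sin]

lemma rot_e2_one (θ : ℝ) : rot θ (e2 1) = -Real.sin θ • e2 0 + Real.cos θ • e2 1 := by
  ext j
  fin_cases j <;>
    simp [rot, rotation_apply, Circle.coe_exp, Complex.exp_mul_I, e2,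
      ← Complex.ofReal_cos, ← Complex.ofReal_sin]

lemma FT_comp_isometry {ρ : V2 → ℝ} (hrad : ∀ x y : V2, ‖x‖ = ‖y‖ → ρ x = ρ y)
    (O : V2 ≃ₗᵢ[ℝ] V2) (k : V2) : FT ρ (O k) = FT ρ k := by
  unfold FT
  rw [← O.measurePreserving.integral_comp O.toHomeomorph.measurableEmbedding]
  simp only [LinearIsometryEquiv.inner_map_map, hrad _ _ (O.norm_map _)]

lemma gradNormSqC_comp_rot {f : V2 → ℂ} {θ : ℝ} (hf : ∀ k, f (rot θ k) = f k) (k : V2) :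
    gradNormSqC f (rot θ k) = gradNormSqC f k := by
  have hL : fderiv ℝ f k =
      (fderiv ℝ f (rot θ k)).comp ((rot θ).toContinuousLinearEquiv : V2 →L[ℝ] V2) := by
    conv_lhs => rw [show f = f ∘ (rot θ).toContinuousLinearEquiv from (funext hf).symm]
    exact (rot θ).toContinuousLinearEquiv.comp_right_fderiv
  have h0 : pd f 0 k = Real.cos θ • pd f 0 (rot θ k) + Real.sin θ • pd f 1 (rot θ k) := by
    simp only [pd, hL]
    simp [rot_e2_zero]
  have h1 : pd f 1 k = -Real.sin θ • pd f 0 (rot θ k) + Real.cos θ • pd f 1 (rot θ k) := by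
    simp only [pd, hL]
    simp [rot_e2_one]
  simp only [gradNormSqC, Fin.sum_univ_two, h0, h1, Complex.sq_norm, Complex.normSq_apply]
  simp [Complex.cos_ofReal_re, Complex.sin_ofReal_re]
  linear_combination
    -((pd f 0 (rot θ k)).re ^ 2 + (pd f 0 (rot θ k)).im ^ 2 + (pd f 1 (rot θ k)).re ^ 2
      + (pd f 1 (rot θ k)).im ^ 2) * Real.sin_sq_add_cos_sq θ

lemma integral_polar (f : V2 → ℝ) :
    ∫ k, f k = ∫ p in Set.Ioi (0 : ℝ) ×ˢ Set.Ioo (-Real.pi) Real.pi,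
      p.1 • f (p.1 • unitVec p.2) := by
  rw [← Complex.orthonormalBasisOneI.repr.measurePreserving.integral_comp
    Complex.orthonormalBasisOneI.repr.toHomeomorph.measurableEmbedding,
    ← Complex.integral_comp_polarCoord_symm]
  refine setIntegral_congr_fun polarCoord.open_target.measurableSet fun p _ => ?_
  congr 2
  ext j
  fin_cases j <;>
    simp [Complex.polarCoord_symm_apply, Complex.cos_ofReal_re, Complex.sin_ofReal_re]

/-- Integration in polar coordinates of a radial function times a function homogeneous of degree
`-2`. No integrability is needed. -/
lemma integral_radial_mul {N F : V2 → ℝ} {φ : ℝ → ℝ} (hN : ∀ θ k, N (rot θ k) = N k)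
    (hF : ∀ r θ, 0 < r → F (r • unitVec θ) = N (r • unitVec θ) * φ θ / r ^ 2) :
    ∫ k, F k = (∫ r in Set.Ioi (0 : ℝ), N (r • unitVec 0) / r)
      * ∫ θ in -Real.pi..Real.pi, φ θ := by
  rw [integral_polar, intervalIntegral.integral_of_le (by linarith [Real.pi_pos]),
    integral_Ioc_eq_integral_Ioo, ← setIntegral_prod_mul]
  refine setIntegral_congr_fun (measurableSet_Ioi.prod measurableSet_Ioo) fun p hp => ?_
  have hr : 0 < p.1 := hp.1
  have hrad : N (p.1 • unitVec p.2) = N (p.1 • unitVec 0) := by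
    rw [← hN p.2 (p.1 • unitVec 0), map_smul, rot_unitVec, add_zero]
  simp only [hF _ _ hr, hrad, smul_eq_mul]
  field_simp

lemma integral_cos_sub (w : ℝ → ℝ) (α : ℝ) :
    ∫ θ in -Real.pi..Real.pi, w (Real.cos (θ - α)) = ∫ θ in -Real.pi..Real.pi, w (Real.cos θ) := by
  have hper : Function.Periodic (fun θ => w (Real.cos θ)) (2 * Real.pi) := fun θ => by simp
  have h := hper.intervalIntegral_add_eq (-Real.pi - α) (-Real.pi)
  rw [intervalIntegral.integral_comp_sub_right (fun θ => w (Real.cos θ))]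
  convert h using 2 <;> ring

lemma integral_comp_cos_mul_sin (w : ℝ → ℝ) :
    ∫ θ in -Real.pi..Real.pi, w (Real.cos θ) * Real.sin θ = 0 := by
  have h := intervalIntegral.integral_comp_neg (a := -Real.pi) (b := Real.pi)
    (fun θ => w (Real.cos θ) * Real.sin θ)
  simp at h
  linarith

lemma integral_comp_cos_sub_mul_unitVec {w : ℝ → ℝ} (hw : Continuous fun θ => w (Real.cos θ))
    (α : ℝ) (j : Fin 2) :
    ∫ θ in -Real.pi..Real.pi, w (Real.cos (θ - α)) * unitVec θ j
      = unitVec α j * ∫ θ in -Real.pi..Real.pi, w (Real.cos θ) * Real.cos θ := by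
  have hc : IntervalIntegrable (fun θ => w (Real.cos θ) * Real.cos θ) volume
      (-Real.pi) Real.pi := (hw.mul Real.continuous_cos).intervalIntegrable _ _
  have hs : IntervalIntegrable (fun θ => w (Real.cos θ) * Real.sin θ) volume
      (-Real.pi) Real.pi := (hw.mul Real.continuous_sin).intervalIntegrable _ _
  have hper : Function.Periodic (fun θ => w (Real.cos θ) * unitVec (θ + α) j) (2 * Real.pi) := by
    intro θ
    fin_cases j <;> simp [add_right_comm θ (2 * Real.pi) α]
  have h := hper.intervalIntegral_add_eq (-Real.pi - α) (-Real.pi)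
  have hshift := intervalIntegral.integral_comp_sub_right (a := -Real.pi) (b := Real.pi)
    (fun θ => w (Real.cos θ) * unitVec (θ + α) j) α
  simp only [sub_add_cancel] at hshift
  rw [show -Real.pi - α + 2 * Real.pi = Real.pi - α by ring,
    show -Real.pi + 2 * Real.pi = Real.pi by ring] at h
  rw [hshift, h]
  fin_cases j
  · simp only [Fin.zero_eta, unitVec_zero_apply]
    calc _ = ∫ θ in -Real.pi..Real.pi, (Real.cos α * (w (Real.cos θ) * Real.cos θ)
          - Real.sin α * (w (Real.cos θ) * Real.sin θ)) := by
            congr 1; ext θ; rw [Real.cos_add]; ring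
      _ = _ := by
        rw [intervalIntegral.integral_sub (hc.const_mul _) (hs.const_mul _),
          intervalIntegral.integral_const_mul, intervalIntegral.integral_const_mul,
          integral_comp_cos_mul_sin, mul_zero, sub_zero]
  · simp only [Fin.mk_one, unitVec_one_apply]
    calc _ = ∫ θ in -Real.pi..Real.pi, (Real.sin α * (w (Real.cos θ) * Real.cos θ)
          + Real.cos α * (w (Real.cos θ) * Real.sin θ)) := by
            congr 1; ext θ; rw [Real.sin_add]; ring
      _ = _ := by
        rw [intervalIntegral.integral_add (hc.const_mul _) (hs.const_mul _),
          intervalIntegral.integral_const_mul, intervalIntegral.integral_const_mul,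
          integral_comp_cos_mul_sin, mul_zero, add_zero]

/-- The angular integral of `1 / D_v` for a velocity of norm `s`. -/
def angG (s : ℝ) : ℝ := ∫ θ in -Real.pi..Real.pi, 1 / (1 - (s * Real.cos θ) ^ 2)

/-- The angular integral of `cos² / D_v²` for a velocity of norm `s`. -/
def angH (s : ℝ) : ℝ :=
  ∫ θ in -Real.pi..Real.pi, Real.cos θ ^ 2 / (1 - (s * Real.cos θ) ^ 2) ^ 2

/-- The angular integral of `sin² / D_v²` for a velocity of norm `s`. -/
def angF (s : ℝ) : ℝ :=
  ∫ θ in -Real.pi..Real.pi, Real.sin θ ^ 2 / (1 - (s * Real.cos θ) ^ 2) ^ 2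

section Angular

variable {s s' : ℝ}

lemma one_sub_sq_pos (hs : 0 ≤ s) (hs1 : s < 1) : 0 < 1 - s ^ 2 := by nlinarith

lemma one_sub_mul_cos_sq_pos (hs : 0 ≤ s) (hs1 : s < 1) (θ : ℝ) :
    0 < 1 - (s * Real.cos θ) ^ 2 := by
  nlinarith [Real.cos_sq_le_one θ, mul_le_mul_of_nonneg_left (Real.cos_sq_le_one θ) (sq_nonneg s)]

lemma one_sub_mul_cos_sq_anti (hs : 0 ≤ s) (h : s ≤ s') (θ : ℝ) :
    1 - (s' * Real.cos θ) ^ 2 ≤ 1 - (s * Real.cos θ) ^ 2 := by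
  have : s ^ 2 ≤ s' ^ 2 := pow_le_pow_left₀ hs h 2
  nlinarith [mul_le_mul_of_nonneg_right this (sq_nonneg (Real.cos θ))]

lemma angG_pos (hs : 0 ≤ s) (hs1 : s < 1) : 0 < angG s := by
  have hD := one_sub_mul_cos_sq_pos hs hs1
  have hD' := fun θ => (hD θ).ne'
  refine intervalIntegral.intervalIntegral_pos_of_pos ?_ (fun θ => by have := hD θ; positivity)
    (by linarith [Real.pi_pos])
  exact Continuous.intervalIntegrable (by fun_prop (disch := simp [hD'])) _ _

lemma angG_mono (hs : 0 ≤ s) (h : s ≤ s') (hs1 : s' < 1) : angG s ≤ angG s' := by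
  have hD := one_sub_mul_cos_sq_pos hs (h.trans_lt hs1)
  have hE := one_sub_mul_cos_sq_pos (hs.trans h) hs1
  have hD' := fun θ => (hD θ).ne'
  have hE' := fun θ => (hE θ).ne'
  refine intervalIntegral.integral_mono (by linarith [Real.pi_pos])
    (Continuous.intervalIntegrable (by fun_prop (disch := simp [hD'])) _ _)
    (Continuous.intervalIntegrable (by fun_prop (disch := simp [hE'])) _ _) fun θ => ?_
  exact one_div_le_one_div_of_le (hE θ) (one_sub_mul_cos_sq_anti hs h θ)

lemma angF_mono (hs : 0 ≤ s) (h : s ≤ s') (hs1 : s' < 1) : angF s ≤ angF s' := by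
  have hD := one_sub_mul_cos_sq_pos hs (h.trans_lt hs1)
  have hE := one_sub_mul_cos_sq_pos (hs.trans h) hs1
  have hD' := fun θ => (hD θ).ne'
  have hE' := fun θ => (hE θ).ne'
  refine intervalIntegral.integral_mono (by linarith [Real.pi_pos])
    (Continuous.intervalIntegrable (by fun_prop (disch := simp [hD'])) _ _)
    (Continuous.intervalIntegrable (by fun_prop (disch := simp [hE'])) _ _) fun θ => ?_
  exact div_le_div_of_nonneg_left (sq_nonneg _) (pow_pos (hE θ) 2)
    (pow_le_pow_left₀ (hE θ).le (one_sub_mul_cos_sq_anti hs h θ) 2)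

lemma angF_nonneg (s : ℝ) : 0 ≤ angF s :=
  intervalIntegral.integral_nonneg (by linarith [Real.pi_pos]) fun θ _ => by positivity

lemma angH_nonneg (s : ℝ) : 0 ≤ angH s :=
  intervalIntegral.integral_nonneg (by linarith [Real.pi_pos]) fun θ _ => by positivity

lemma one_sub_sq_mul_angG_anti (hs : 0 ≤ s) (h : s ≤ s') (hs1 : s' < 1) :
    (1 - s' ^ 2) * angG s' ≤ (1 - s ^ 2) * angG s := by
  have hD := one_sub_mul_cos_sq_pos hs (h.trans_lt hs1)
  have hE := one_sub_mul_cos_sq_pos (hs.trans h) hs1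
  have hD' := fun θ => (hD θ).ne'
  have hE' := fun θ => (hE θ).ne'
  unfold angG
  rw [← intervalIntegral.integral_const_mul, ← intervalIntegral.integral_const_mul]
  refine intervalIntegral.integral_mono (by linarith [Real.pi_pos])
    (Continuous.intervalIntegrable (by fun_prop (disch := simp [hE'])) _ _)
    (Continuous.intervalIntegrable (by fun_prop (disch := simp [hD'])) _ _) fun θ => ?_
  simp only [mul_one_div]
  rw [div_le_div_iff₀ (hE θ) (hD θ)]
  have : s ^ 2 ≤ s' ^ 2 := pow_le_pow_left₀ hs h 2
  nlinarith [mul_nonneg (sub_nonneg.2 this) (sub_nonneg.2 (Real.cos_sq_le_one θ))]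

/-- Obtained by integrating the derivative of `sin θ cos θ / (1 - s² cos² θ)` over a period. -/
lemma angG_eq_mul_angH (hs : 0 ≤ s) (hs1 : s < 1) :
    angG s = 2 * (1 - s ^ 2) * angH s := by
  have hD := one_sub_mul_cos_sq_pos hs hs1
  have hD' := fun θ => (hD θ).ne'
  have hderiv : ∀ θ, HasDerivAt
      (fun θ => Real.sin θ * Real.cos θ / (1 - (s * Real.cos θ) ^ 2))
      (2 * (1 - s ^ 2) * (Real.cos θ ^ 2 / (1 - (s * Real.cos θ) ^ 2) ^ 2)
        - 1 / (1 - (s * Real.cos θ) ^ 2)) θ := by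
    intro θ
    have h := ((Real.hasDerivAt_sin θ).mul (Real.hasDerivAt_cos θ)).div
      ((((Real.hasDerivAt_cos θ).const_mul s).pow 2).const_sub 1) (hD' θ)
    refine HasDerivAt.congr_deriv h ?_
    have hdiv : 1 / (1 - (s * Real.cos θ) ^ 2)
        = (1 - (s * Real.cos θ) ^ 2) / (1 - (s * Real.cos θ) ^ 2) ^ 2 := by
      rw [sq (1 - (s * Real.cos θ) ^ 2), div_mul_cancel_left₀ (hD' θ), one_div]
    rw [hdiv, ← mul_div_assoc, ← sub_div]
    simp only [Pi.mul_apply, Pi.pow_apply, Nat.cast_ofNat]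
    congr 1
    linear_combination -(1 + s ^ 2 * Real.cos θ ^ 2) * Real.sin_sq_add_cos_sq θ
  have hG : IntervalIntegrable (fun θ => 1 / (1 - (s * Real.cos θ) ^ 2)) volume
      (-Real.pi) Real.pi :=
    Continuous.intervalIntegrable (by fun_prop (disch := simp [hD'])) _ _
  have hH : IntervalIntegrable (fun θ => 2 * (1 - s ^ 2) *
      (Real.cos θ ^ 2 / (1 - (s * Real.cos θ) ^ 2) ^ 2)) volume (-Real.pi) Real.pi :=
    Continuous.intervalIntegrable (by fun_prop (disch := simp [hD'])) _ _
  have h := intervalIntegral.integral_eq_sub_of_hasDerivAt (a := -Real.pi) (b := Real.pi)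
    (fun θ _ => hderiv θ) (hH.sub hG)
  rw [intervalIntegral.integral_sub hH hG, intervalIntegral.integral_const_mul] at h
  simp only [Real.sin_neg, Real.sin_pi, neg_zero, zero_mul, zero_div, sub_zero] at h
  change 2 * (1 - s ^ 2) * angH s - angG s = 0 at h
  linarith

lemma angH_div_sq_mono (hs : 0 ≤ s) (h : s ≤ s') (hs1 : s' < 1) {I b : ℝ} (hI : 0 < I)
    (hb : 0 ≤ b) :
    angH s / (I + b * angG s) ^ 2 ≤ angH s' / (I + b * angG s') ^ 2 := by
  have hs1' := h.trans_lt hs1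
  have hg := angG_pos hs hs1'
  have hg' := angG_pos (hs.trans h) hs1
  have hx := one_sub_sq_pos hs hs1'
  have hx' := one_sub_sq_pos (hs.trans h) hs1
  have hgg := angG_mono hs h hs1
  have hxg := one_sub_sq_mul_angG_anti hs h hs1
  have hxx : 1 - s' ^ 2 ≤ 1 - s ^ 2 := sub_le_sub_left (pow_le_pow_left₀ hs h 2) 1
  rw [show angH s = angG s / (2 * (1 - s ^ 2)) by
      rw [angG_eq_mul_angH hs hs1']; field_simp,
    show angH s' = angG s' / (2 * (1 - s' ^ 2)) by
      rw [angG_eq_mul_angH (hs.trans h) hs1]; field_simp]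
  generalize angG s = g at *
  generalize angG s' = g' at *
  generalize 1 - s ^ 2 = x at *
  generalize 1 - s' ^ 2 = x' at *
  rw [div_div, div_div, div_le_div_iff₀ (by positivity) (by positivity)]
  have h1 : g * x' * I ^ 2 ≤ g' * x * I ^ 2 := by gcongr
  have h2 : x' * (g * g' * I * b) ≤ x * (g * g' * I * b) := by gcongr
  have h3 : x' * g' * (g * g' * b ^ 2) ≤ x * g * (g * g' * b ^ 2) := by gcongr
  nlinarith

end Angular

section Polar

variable {s r : ℝ}

lemma inner_smul_unitVec (s r α θ : ℝ) :
    (⟪s • unitVec α, r • unitVec θ⟫ : ℝ) = r * (s * Real.cos (θ - α)) := by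
  rw [real_inner_smul_left, real_inner_smul_right, inner_unitVec]
  ring

lemma norm_smul_unitVec (hr : 0 ≤ r) (θ : ℝ) : ‖r • unitVec θ‖ = r := by
  rw [norm_smul, norm_unitVec, mul_one, Real.norm_of_nonneg hr]

lemma Dv_smul_unitVec (hr : 0 ≤ r) (s α θ : ℝ) :
    Dv (s • unitVec α) (r • unitVec θ) = r ^ 2 * (1 - (s * Real.cos (θ - α)) ^ 2) := by
  rw [Dv, norm_smul_unitVec hr, inner_smul_unitVec]
  ring

lemma integral_div_Dv {N : V2 → ℝ} (hN : ∀ θ k, N (rot θ k) = N k) (s α : ℝ) :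
    ∫ k, N k / Dv (s • unitVec α) k
      = (∫ r in Set.Ioi (0 : ℝ), N (r • unitVec 0) / r) * angG s := by
  rw [integral_radial_mul (φ := fun θ => 1 / (1 - (s * Real.cos (θ - α)) ^ 2)) hN fun r θ hr => by
      rw [Dv_smul_unitVec hr.le, mul_one_div, div_div, mul_comm (r ^ 2)],
    integral_cos_sub (fun c => 1 / (1 - (s * c) ^ 2)) α]
  rfl

lemma integral_inner_mul_div_Dv_sq {N : V2 → ℝ} (hN : ∀ θ k, N (rot θ k) = N k)
    (hs : 0 ≤ s) (hs1 : s < 1) (α : ℝ) (j : Fin 2) :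
    ∫ k, (⟪s • unitVec α, k⟫ : ℝ) * k j * N k / (Dv (s • unitVec α) k) ^ 2
      = unitVec α j * s * (∫ r in Set.Ioi (0 : ℝ), N (r • unitVec 0) / r) * angH s := by
  have hD' := fun θ => (one_sub_mul_cos_sq_pos hs hs1 θ).ne'
  rw [integral_radial_mul (φ := fun θ => s * Real.cos (θ - α) /
      (1 - (s * Real.cos (θ - α)) ^ 2) ^ 2 * unitVec θ j) hN fun r θ hr => by
      have := hD' (θ - α)
      rw [Dv_smul_unitVec hr.le, inner_smul_unitVec, PiLp.smul_apply, smul_eq_mul]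
      field_simp,
    integral_comp_cos_sub_mul_unitVec (w := fun c => s * c / (1 - (s * c) ^ 2) ^ 2)
      (by fun_prop (disch := simp [hD'])) α j, angH]
  have h : ∫ θ in -Real.pi..Real.pi,
      s * Real.cos θ / (1 - (s * Real.cos θ) ^ 2) ^ 2 * Real.cos θ
      = s * ∫ θ in -Real.pi..Real.pi, Real.cos θ ^ 2 / (1 - (s * Real.cos θ) ^ 2) ^ 2 := by
    rw [← intervalIntegral.integral_const_mul]
    congr 1; ext θ; ring
  rw [h]
  ring

lemma charge_terms_eq {N : V2 → ℝ} (hN : ∀ θ k, N (rot θ k) = N k)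
    (hs : 0 ≤ s) (hs1 : s < 1) (α : ℝ) (j : Fin 2) :
    (s • unitVec α) j * (∫ k, N k / Dv (s • unitVec α) k)
      - (∫ k, (⟪s • unitVec α, k⟫ : ℝ) * k j * N k / (‖k‖ ^ 2 * Dv (s • unitVec α) k))
      + (∫ k, (‖s • unitVec α‖ ^ 2 - (⟪s • unitVec α, k⟫ : ℝ) ^ 2 / ‖k‖ ^ 2)
        * (⟪s • unitVec α, k⟫ : ℝ) * k j * N k / (Dv (s • unitVec α) k) ^ 2)
      = unitVec α j * s * (∫ r in Set.Ioi (0 : ℝ), N (r • unitVec 0) / r) * angF s := by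
  have hD' := fun θ => (one_sub_mul_cos_sq_pos hs hs1 θ).ne'
  have h2 := integral_radial_mul (N := N)
    (F := fun k => (⟪s • unitVec α, k⟫ : ℝ) * k j * N k / (‖k‖ ^ 2 * Dv (s • unitVec α) k))
    (φ := fun θ => s * Real.cos (θ - α) / (1 - (s * Real.cos (θ - α)) ^ 2) * unitVec θ j) hN
    fun r θ hr => by
      have := hD' (θ - α)
      rw [Dv_smul_unitVec hr.le, inner_smul_unitVec, norm_smul_unitVec hr.le, PiLp.smul_apply,
        smul_eq_mul]
      field_simp
  have h3 := integral_radial_mul (N := N)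
    (F := fun k => (‖s • unitVec α‖ ^ 2 - (⟪s • unitVec α, k⟫ : ℝ) ^ 2 / ‖k‖ ^ 2)
        * (⟪s • unitVec α, k⟫ : ℝ) * k j * N k / (Dv (s • unitVec α) k) ^ 2)
    (φ := fun θ => (s ^ 2 - (s * Real.cos (θ - α)) ^ 2) * (s * Real.cos (θ - α)) /
      (1 - (s * Real.cos (θ - α)) ^ 2) ^ 2 * unitVec θ j) hN
    fun r θ hr => by
      have := hD' (θ - α)
      rw [Dv_smul_unitVec hr.le, inner_smul_unitVec, norm_smul_unitVec hr.le,
        norm_smul_unitVec hs, PiLp.smul_apply, smul_eq_mul]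
      field_simp
  rw [integral_comp_cos_sub_mul_unitVec (w := fun c => s * c / (1 - (s * c) ^ 2))
      (by fun_prop (disch := simp [hD'])) α j] at h2
  rw [integral_comp_cos_sub_mul_unitVec
      (w := fun c => (s ^ 2 - (s * c) ^ 2) * (s * c) / (1 - (s * c) ^ 2) ^ 2)
      (by fun_prop (disch := simp [hD'])) α j] at h3
  have hF : s * angG s
      - (∫ θ in -Real.pi..Real.pi, s * Real.cos θ / (1 - (s * Real.cos θ) ^ 2) * Real.cos θ)
      + (∫ θ in -Real.pi..Real.pi, (s ^ 2 - (s * Real.cos θ) ^ 2) * (s * Real.cos θ) /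
        (1 - (s * Real.cos θ) ^ 2) ^ 2 * Real.cos θ) = s * angF s := by
    rw [angG, angF, ← intervalIntegral.integral_const_mul, ← intervalIntegral.integral_const_mul,
      ← intervalIntegral.integral_sub, ← intervalIntegral.integral_add]
    · congr 1
      ext θ
      have := hD' θ
      rw [Real.sin_sq]
      field_simp
      ring
    all_goals exact Continuous.intervalIntegrable (by fun_prop (disch := simp [hD'])) _ _
  rw [integral_div_Dv hN, h2, h3, PiLp.smul_apply, smul_eq_mul]
  linear_combination unitVec α j * (∫ r in Set.Ioi (0 : ℝ), N (r • unitVec 0) / r) * hF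

end Polar

lemma radial_integral_nonneg {N : V2 → ℝ} (hN : ∀ k, 0 ≤ N k) :
    0 ≤ ∫ r in Set.Ioi (0 : ℝ), N (r • unitVec 0) / r :=
  setIntegral_nonneg measurableSet_Ioi fun _ hr => div_nonneg (hN _) (le_of_lt hr)

/-- For a radial charge distribution, the momentum map in polar coordinates of the velocity. -/
lemma exists_momentum_polar {ρ : V2 → ℝ} (hrad : ∀ x y : V2, ‖x‖ = ‖y‖ → ρ x = ρ y) :
    ∃ a b : ℝ, 0 ≤ a ∧ 0 ≤ b ∧ ∀ (m I s α ω : ℝ), 0 ≤ s → s < 1 →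
      (∀ j, Pform ρ m (s • unitVec α) ω j
        = unitVec α j * (s * (m + a * angF s + ω ^ 2 * b * angH s))) ∧
      Mform ρ I (s • unitVec α) ω = ω * (I + b * angG s) := by
  have hFT : ∀ θ k, FT ρ (rot θ k) = FT ρ k := fun θ k => FT_comp_isometry hrad (rot θ) k
  have hR : ∀ θ k, ‖FT ρ (rot θ k)‖ ^ 2 = ‖FT ρ k‖ ^ 2 := fun θ k => by rw [hFT]
  have hG : ∀ θ k, gradNormSqC (FT ρ) (rot θ k) = gradNormSqC (FT ρ) k :=
    fun θ k => gradNormSqC_comp_rot (hFT θ) k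
  refine ⟨_, _, radial_integral_nonneg (N := fun k => ‖FT ρ k‖ ^ 2) fun k => sq_nonneg _,
    radial_integral_nonneg (N := gradNormSqC (FT ρ)) fun k => Finset.sum_nonneg fun j _ =>
      sq_nonneg _, fun m I s α ω hs hs1 => ⟨fun j => ?_, ?_⟩⟩
  · have h := charge_terms_eq (N := fun k => ‖FT ρ k‖ ^ 2) hR hs hs1 α j
    rw [Pform, integral_inner_mul_div_Dv_sq hG hs hs1, PiLp.smul_apply, smul_eq_mul]
    rw [PiLp.smul_apply, smul_eq_mul] at h
    linear_combination h
  · rw [Mform, integral_div_Dv hG]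

/-- At fixed angular momentum, the radial part of the linear momentum determines the speed. -/
lemma speed_le_of_momentum_eq {m I a b s s' ω ω' : ℝ} (hm : 0 < m) (hI : 0 < I) (ha : 0 ≤ a)
    (hb : 0 ≤ b) (hs : 0 ≤ s) (hs' : 0 ≤ s') (hs1 : s < 1)
    (hM : ω * (I + b * angG s) = ω' * (I + b * angG s'))
    (hP : s * (m + a * angF s + ω ^ 2 * b * angH s)
      = s' * (m + a * angF s' + ω' ^ 2 * b * angH s')) : s ≤ s' := by
  by_contra! hlt
  have hs1' := hlt.trans hs1
  have hK : 0 < I + b * angG s := by have := angG_pos hs hs1; positivity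
  have hK' : 0 < I + b * angG s' := by have := angG_pos hs' hs1'; positivity
  have hH : ω' ^ 2 * b * angH s' ≤ ω ^ 2 * b * angH s := by
    have h := mul_le_mul_of_nonneg_left (angH_div_sq_mono hs' hlt.le hs1 hI hb)
      (by positivity : 0 ≤ b * (ω * (I + b * angG s)) ^ 2)
    calc ω' ^ 2 * b * angH s'
        = b * (ω * (I + b * angG s)) ^ 2 * (angH s' / (I + b * angG s') ^ 2) := by
          rw [hM]; field_simp
      _ ≤ _ := h
      _ = ω ^ 2 * b * angH s := by field_simp
  have hF : a * angF s' ≤ a * angF s :=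
    mul_le_mul_of_nonneg_left (angF_mono hs' hlt.le hs1) ha
  have hpos : 0 < m + a * angF s + ω ^ 2 * b * angH s := by
    have h1 := angF_nonneg s
    have h2 := angH_nonneg s
    positivity
  have h1 := mul_lt_mul_of_pos_right hlt hpos
  have h2 := mul_le_mul_of_nonneg_left (add_le_add (add_le_add_right hF m) hH) hs'
  linarith

/-- the momentum map `F(v,ω) = (P(v,ω), M(v,ω))` is injective on
`Σ = {|v| < 1}`: distinct parameters have distinct momenta (uniqueness of the soliton
with given total linear and angular momenta). -/
theorem momentum_map_injective
    (ρ : SchwartzMap V2 ℝ)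
    (hrad : ∀ x y : V2, ‖x‖ = ‖y‖ → ρ x = ρ y)
    (hneu : (∫ x : V2, ρ x) = 0)
    (m I : ℝ) (hm : 0 < m) (hI : 0 < I) :
    ∀ (v v' : V2) (ω ω' : ℝ), ‖v‖ < 1 → ‖v'‖ < 1 →
      Fmap (⇑ρ) m I (v, ω) = Fmap (⇑ρ) m I (v', ω') → (v, ω) = (v', ω') := by
  intro v v' ω ω' hv hv' hF
  obtain ⟨a, b, ha, hb, hpol⟩ := exists_momentum_polar hrad
  obtain ⟨s, α, hs, hsv, rfl⟩ := exists_polar v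
  obtain ⟨s', α', hs', hsv', rfl⟩ := exists_polar v'
  rw [← hsv] at hv
  rw [← hsv'] at hv'
  obtain ⟨hP, hM⟩ := hpol m I s α ω hs hv
  obtain ⟨hP', hM'⟩ := hpol m I s' α' ω' hs' hv'
  have hFM : ω * (I + b * angG s) = ω' * (I + b * angG s') := by
    rw [← hM, ← hM']; exact congrArg Prod.snd hF
  set p := m + a * angF s + ω ^ 2 * b * angH s
  set p' := m + a * angF s' + ω' ^ 2 * b * angH s'
  have hFP : ∀ j, unitVec α j * (s * p) = unitVec α' j * (s' * p') := fun j => by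
    rw [← hP, ← hP']; exact congrArg (fun q : V2 × ℝ => q.1 j) hF
  have hpos : ∀ t w : ℝ, 0 < m + a * angF t + w ^ 2 * b * angH t := fun t w => by
    have h1 := angF_nonneg t
    have h2 := angH_nonneg t
    positivity
  have hnorm : s * p = s' * p' := by
    have h0 := hFP 0
    have h1 := hFP 1
    simp only [unitVec_zero_apply, unitVec_one_apply] at h0 h1
    refine (sq_eq_sq₀ (mul_nonneg hs (hpos s ω).le) (mul_nonneg hs' (hpos s' ω').le)).1 ?_
    linear_combination (Real.cos α * (s * p) + Real.cos α' * (s' * p')) * h0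
      + (Real.sin α * (s * p) + Real.sin α' * (s' * p')) * h1
      - (s * p) ^ 2 * Real.sin_sq_add_cos_sq α + (s' * p') ^ 2 * Real.sin_sq_add_cos_sq α'
  have hss : s = s' := le_antisymm
    (speed_le_of_momentum_eq hm hI ha hb hs hs' hv hFM hnorm)
    (speed_le_of_momentum_eq hm hI ha hb hs' hs hv' hFM.symm hnorm.symm)
  subst hss
  have hK : 0 < I + b * angG s := by have := angG_pos hs hv; positivity
  obtain rfl : ω = ω' := mul_right_cancel₀ hK.ne' hFM
  have hvec : s • unitVec α = s • unitVec α' := by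
    ext j
    refine mul_right_cancel₀ (hpos s ω).ne' ?_
    have := hFP j
    simp only [PiLp.smul_apply, smul_eq_mul]
    linear_combination this
  rw [hvec]

end
end

section
/- Let ρ be a real-valued radial neutral Schwartz function on ℝ². Then the soliton map (v,ω) ↦ (A_{v,ω}, Π_{v,ω}) is continuous from {(v,ω) ∈ ℝ² × ℝ : |v| < 1} into Ḣ¹ × L²: if (v_n, ω_n) → (v,ω) with |v_n| < 1 and |v| < 1, then ∫_{ℝ²} |k|² |Â_{v_n,ω_n}(k) − Â_{v,ω}(k)|² dk → 0 and ∫_{ℝ²} |(v_n·k)Â_{v_n,ω_n}(k) − (v·k)Â_{v,ω}(k)|² dk → 0. -/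
open MeasureTheory
open scoped RealInnerProductSpace BigOperators

noncomputable section

/-- The Fourier transform of a real Schwartz function is (the coercion of) a Schwartz function. -/
lemma exists_schwartz_eq_FT (ρ : SchwartzMap V2 ℝ) :
    ∃ S : SchwartzMap V2 ℂ, ⇑S = FT ρ := by
  have hc : (2 * Real.pi)⁻¹ ≠ 0 := by positivity
  refine ⟨((2 * Real.pi : ℝ) : ℂ)⁻¹ • SchwartzMap.compCLMOfContinuousLinearEquiv ℂ
    (ContinuousLinearEquiv.smulLeft (Units.mk0 ((2 * Real.pi)⁻¹ : ℝ) hc) : V2 ≃L[ℝ] V2)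
    (FourierTransform.fourier (ρ.postcompCLM Complex.ofRealCLM)), ?_⟩
  ext k
  simp only [smul_apply, SchwartzMap.compCLMOfContinuousLinearEquiv_apply,
    Function.comp_apply, SchwartzMap.fourier_coe, Real.fourier_eq', FT, smul_eq_mul]
  congr 1
  refine integral_congr_ae (Filter.Eventually.of_forall fun x => ?_)
  simp only [SchwartzMap.postcompCLM_apply, Complex.ofRealCLM_apply]
  congr 2
  have : (ContinuousLinearEquiv.smulLeft (Units.mk0 ((2 * Real.pi)⁻¹ : ℝ) hc) : V2 ≃L[ℝ] V2) k
      = (2 * Real.pi)⁻¹ • k := rfl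
  rw [this, real_inner_smul_right, real_inner_comm]
  push_cast
  field_simp

lemma FT_zero {ρ : V2 → ℝ} (h : ∫ x, ρ x = 0) : FT ρ 0 = 0 := by
  simp [FT, integral_complex_ofReal, h]

lemma FT_neg {ρ : V2 → ℝ} (h : ∀ x, ρ (-x) = ρ x) (k : V2) : FT ρ (-k) = FT ρ k := by
  unfold FT
  congr 1
  rw [← integral_neg_eq_self]
  simp [h]

lemma fderiv_zero_of_even {f : V2 → ℂ} (h : ∀ k, f (-k) = f k) : fderiv ℝ f 0 = 0 := by
  have h1 := fderiv_comp_smul (𝕜 := ℝ) (f := f) (x := 0) (-1)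
  simp only [neg_smul, one_smul, h, neg_zero] at h1
  ext x
  have h2 : fderiv ℝ f 0 x = -fderiv ℝ f 0 x := DFunLike.congr_fun h1 x
  simpa using self_eq_neg.mp h2

/-- A Schwartz function vanishing at the origin stays square integrable after division by `‖k‖`. -/
lemma SchwartzMap.integrable_norm_sq_div {E : Type*} [NormedAddCommGroup E] [NormedSpace ℝ E]
    (G : SchwartzMap V2 E) (h0 : G 0 = 0) :
    Integrable (fun k : V2 => ‖G k‖ ^ 2 / ‖k‖ ^ 2) := by
  obtain ⟨C, hC⟩ : ∃ C : ℝ, ∀ k, ‖fderiv ℝ G k‖ ≤ C :=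
    ⟨_, fun k => SchwartzMap.norm_le_seminorm ℝ (SchwartzMap.fderivCLM ℝ V2 E G) k⟩
  have hlip : ∀ k, ‖G k‖ ≤ C * ‖k‖ := fun k => by
    simpa [h0] using convex_univ.norm_image_sub_le_of_norm_fderiv_le (𝕜 := ℝ) (f := G)
      (fun x _ => G.differentiableAt) (fun x _ => hC x) (Set.mem_univ 0) (Set.mem_univ k)
  have hb : Integrable (fun k : V2 =>
      (Metric.ball (0 : V2) 1).indicator (fun _ => C ^ 2) k + ‖G k‖ ^ 2) := by
    refine Integrable.add ?_ ?_
    · exact (integrable_indicator_iff measurableSet_ball).2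
        (integrableOn_const measure_ball_lt_top.ne)
    · exact (G.memLp 2 volume).integrable_norm_pow (by norm_num)
  have hm : Measurable fun k : V2 => ‖G k‖ ^ 2 / ‖k‖ ^ 2 :=
    (G.continuous.norm.pow 2).measurable.div (continuous_norm.pow 2).measurable
  refine hb.mono' hm.aestronglyMeasurable (Filter.Eventually.of_forall fun k => ?_)
  rw [Real.norm_of_nonneg (by positivity)]
  by_cases hk : ‖k‖ < 1
  · rw [Set.indicator_of_mem (by simpa using hk)]
    have : ‖G k‖ ^ 2 / ‖k‖ ^ 2 ≤ C ^ 2 := by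
      refine div_le_of_le_mul₀ (by positivity) (by positivity) ?_
      rw [← mul_pow]
      exact pow_le_pow_left₀ (norm_nonneg _) (hlip k) 2
    nlinarith [sq_nonneg ‖G k‖]
  · rw [Set.indicator_of_notMem (by simpa using hk), zero_add]
    exact div_le_self (by positivity) (one_le_pow₀ (not_lt.1 hk))

lemma Dv_lower_bound {v : V2} {r : ℝ} (hv : ‖v‖ ≤ r) (k : V2) :
    (1 - r ^ 2) * ‖k‖ ^ 2 ≤ Dv v k := by
  have h1 : ⟪v, k⟫ ^ 2 ≤ (r * ‖k‖) ^ 2 := by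
    rw [← sq_abs]
    exact pow_le_pow_left₀ (abs_nonneg _) ((abs_real_inner_le_norm v k).trans (by gcongr)) 2
  unfold Dv
  linarith [mul_pow r ‖k‖ 2]

lemma norm_pd_le (f : V2 → ℂ) (j : Fin 2) (k : V2) : ‖pd f j k‖ ≤ ‖fderiv ℝ f k‖ := by
  simpa [pd, e2] using (fderiv ℝ f k).le_opNorm (e2 j)

lemma norm_Jgrad_le (f : V2 → ℂ) (j : Fin 2) (k : V2) : ‖Jgrad f j k‖ ≤ ‖fderiv ℝ f k‖ := by
  fin_cases j <;> simp [Jgrad, norm_pd_le]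

lemma norm_mul_norm_Ahat_le (ρ : V2 → ℝ) {v : V2} {ω r W : ℝ} (hr : r < 1) (hv : ‖v‖ ≤ r)
    (hω : |ω| ≤ W) (j : Fin 2) (k : V2) :
    ‖k‖ * ‖Ahat ρ v ω j k‖
      ≤ (2 * ‖FT ρ k‖ + W * ‖fderiv ℝ (FT ρ) k‖) / ((1 - r ^ 2) * ‖k‖) := by
  rcases eq_or_ne k 0 with rfl | hk
  · simp
  have hk' : 0 < ‖k‖ := norm_pos_iff.2 hk
  have hr0 : 0 ≤ r := (norm_nonneg v).trans hv
  have hr2 : 0 < 1 - r ^ 2 := by nlinarith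
  have hD := Dv_lower_bound hv k
  have hD0 : 0 < (1 - r ^ 2) * ‖k‖ ^ 2 := by positivity
  have hcoef : |v j - k j * ⟪v, k⟫ / ‖k‖ ^ 2| ≤ 2 := by
    have h1 : |v j| ≤ 1 := ((PiLp.norm_apply_le v j).trans hv).trans hr.le
    have h2 : |k j * ⟪v, k⟫ / ‖k‖ ^ 2| ≤ 1 := by
      rw [abs_div, abs_mul, abs_of_pos (pow_pos hk' 2), div_le_one (by positivity), sq]
      have h3 : |⟪v, k⟫| ≤ ‖k‖ := by
        nlinarith [abs_real_inner_le_norm v k]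
      exact mul_le_mul (PiLp.norm_apply_le k j) h3 (abs_nonneg _) (norm_nonneg _)
    linarith [abs_sub (v j) (k j * ⟪v, k⟫ / ‖k‖ ^ 2)]
  have hnum : ‖((v j - k j * ⟪v, k⟫ / ‖k‖ ^ 2 : ℝ) : ℂ) * FT ρ k
      - Complex.I * (ω : ℂ) * Jgrad (FT ρ) j k‖ ≤ 2 * ‖FT ρ k‖ + W * ‖fderiv ℝ (FT ρ) k‖ := by
    refine (norm_sub_le _ _).trans (add_le_add ?_ ?_)
    · rw [norm_mul, Complex.norm_real, Real.norm_eq_abs]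
      gcongr
    · rw [norm_mul, norm_mul, Complex.norm_I, one_mul, Complex.norm_real, Real.norm_eq_abs]
      exact mul_le_mul hω (norm_Jgrad_le _ _ _) (norm_nonneg _) ((abs_nonneg _).trans hω)
  rw [Ahat, norm_div, Complex.norm_real, Real.norm_of_nonneg (hD0.le.trans hD)]
  calc ‖k‖ * (_ / Dv v k)
      ≤ ‖k‖ * ((2 * ‖FT ρ k‖ + W * ‖fderiv ℝ (FT ρ) k‖) / ((1 - r ^ 2) * ‖k‖ ^ 2)) := by
        gcongr
        exact (norm_nonneg _).trans hnum
    _ = _ := by field_simp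

lemma measurable_Ahat {ρ : V2 → ℝ} (hρ : Measurable (FT ρ)) (v : V2) (ω : ℝ) (j : Fin 2) :
    Measurable (Ahat ρ v ω j) := by
  have hpd : ∀ i, Measurable (pd (FT ρ) i) := fun i => measurable_fderiv_apply_const ℝ (FT ρ) (e2 i)
  have hJ : Measurable (Jgrad (FT ρ) j) := by
    fin_cases j
    · exact hpd 1
    · exact (hpd 0).neg
  unfold Ahat Dv
  fun_prop

section

open Filter Topology

lemma tendsto_Ahat (ρ : V2 → ℝ) {ι : Type*} {l : Filter ι} {v : ι → V2} {ω : ι → ℝ} {v₀ : V2}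
    {ω₀ : ℝ} (hv₀ : ‖v₀‖ < 1) (hv : Tendsto v l (𝓝 v₀)) (hω : Tendsto ω l (𝓝 ω₀))
    (j : Fin 2) (k : V2) :
    Tendsto (fun n => Ahat ρ (v n) (ω n) j k) l (𝓝 (Ahat ρ v₀ ω₀ j k)) := by
  rcases eq_or_ne k 0 with rfl | hk
  · simp [Ahat, Dv, tendsto_const_nhds]
  have hD : 0 < Dv v₀ k := by
    refine lt_of_lt_of_le ?_ (Dv_lower_bound le_rfl k)
    have := norm_pos_iff.2 hk
    have : 0 < 1 - ‖v₀‖ ^ 2 := by nlinarith [norm_nonneg v₀]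
    positivity
  have hi : Tendsto (fun n => ⟪v n, k⟫) l (𝓝 ⟪v₀, k⟫) := hv.inner tendsto_const_nhds
  have hvj : Tendsto (fun n => v n j) l (𝓝 (v₀ j)) :=
    ((EuclideanSpace.proj (𝕜 := ℝ) j).continuous.tendsto v₀).comp hv
  have hcast {f : ι → ℝ} {a : ℝ} (h : Tendsto f l (𝓝 a)) :
      Tendsto (fun n => (f n : ℂ)) l (𝓝 (a : ℂ)) := (Complex.continuous_ofReal.tendsto a).comp h
  exact (((hcast (hvj.sub ((hi.const_mul (k j)).div_const _))).mul_const _).sub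
    (((hcast hω).const_mul _).mul_const _)).div
    (hcast ((hi.pow 2).const_sub _)) (by exact_mod_cast hD.ne')

/-- Dominated convergence in `L²` for pairs of functions. -/
lemma tendsto_integral_sum_norm_sub_sq {T : ℕ → Fin 2 → V2 → ℂ} {T₀ : Fin 2 → V2 → ℂ} {B : V2 → ℝ}
    (hm : ∀ n j, Measurable (T n j)) (hm₀ : ∀ j, Measurable (T₀ j))
    (hB : Integrable fun k => B k ^ 2)
    (hT : ∀ᶠ n in atTop, ∀ j k, ‖T n j k‖ ≤ B k) (hT₀ : ∀ j k, ‖T₀ j k‖ ≤ B k)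
    (hlim : ∀ j k, Tendsto (fun n => T n j k) atTop (𝓝 (T₀ j k))) :
    Tendsto (fun n => ∫ k, ∑ j, ‖T n j k - T₀ j k‖ ^ 2) atTop (𝓝 0) := by
  rw [← integral_zero V2 ℝ]
  refine tendsto_integral_filter_of_dominated_convergence (fun k => 8 * B k ^ 2)
    (Eventually.of_forall fun n => ?_) ?_ (hB.const_mul 8) (Eventually.of_forall fun k => ?_)
  · exact (Finset.measurable_sum _ fun j _ =>
      (((hm n j).sub (hm₀ j)).norm.pow_const 2)).aestronglyMeasurable
  · filter_upwards [hT] with n hn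
    refine Eventually.of_forall fun k => ?_
    rw [Real.norm_of_nonneg (Finset.sum_nonneg fun _ _ => sq_nonneg _)]
    have h : ∀ j, ‖T n j k - T₀ j k‖ ^ 2 ≤ 4 * B k ^ 2 := fun j => by
      have h1 : ‖T n j k - T₀ j k‖ ≤ 2 * B k :=
        (norm_sub_le _ _).trans (by linarith [hn j k, hT₀ j k])
      nlinarith [pow_le_pow_left₀ (norm_nonneg _) h1 2]
    rw [Fin.sum_univ_two]
    linarith [h 0, h 1]
  · have h : ∀ j, Tendsto (fun n => ‖T n j k - T₀ j k‖ ^ 2) atTop (𝓝 0) := fun j => by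
      simpa using (((hlim j k).sub_const (T₀ j k)).norm.pow 2)
    simpa using tendsto_finsetSum Finset.univ fun j _ => h j

/-- Square integrability of the dominating function for the soliton fields. -/
lemma integrable_dominating_sq (ρ : SchwartzMap V2 ℝ)
    (hrad : ∀ x y : V2, ‖x‖ = ‖y‖ → ρ x = ρ y) (hneu : (∫ x : V2, ρ x) = 0) (W c : ℝ) :
    Integrable fun k : V2 =>
      ((2 * ‖FT ρ k‖ + W * ‖fderiv ℝ (FT ρ) k‖) / (c * ‖k‖)) ^ 2 := by
  obtain ⟨S, hS⟩ := exists_schwartz_eq_FT ρ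
  have h1 := S.integrable_norm_sq_div (by rw [hS, FT_zero hneu])
  have h2 := (SchwartzMap.fderivCLM ℝ V2 ℂ S).integrable_norm_sq_div (by
    rw [SchwartzMap.fderivCLM_apply, hS]
    exact fderiv_zero_of_even (FT_neg fun x => hrad _ _ (norm_neg x)))
  simp only [SchwartzMap.fderivCLM_apply, hS] at h1 h2
  have hmF : Measurable (FT ρ) := hS ▸ S.continuous.measurable
  have hmD : Measurable (fderiv ℝ (FT ρ)) := measurable_fderiv ℝ (FT ρ)
  refine ((h1.const_mul (8 / c ^ 2)).add (h2.const_mul (2 * W ^ 2 / c ^ 2))).mono'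
    (Measurable.aestronglyMeasurable (by fun_prop)) (Eventually.of_forall fun k => ?_)
  rw [Real.norm_of_nonneg (sq_nonneg _), div_pow, mul_pow c]
  set a := ‖FT ρ k‖
  set b := ‖fderiv ℝ (FT ρ) k‖
  calc (2 * a + W * b) ^ 2 / (c ^ 2 * ‖k‖ ^ 2)
      ≤ (8 * a ^ 2 + 2 * W ^ 2 * b ^ 2) / (c ^ 2 * ‖k‖ ^ 2) := by
        gcongr
        nlinarith [sq_nonneg (2 * a - W * b)]
    _ = 8 / c ^ 2 * (a ^ 2 / ‖k‖ ^ 2) + 2 * W ^ 2 / c ^ 2 * (b ^ 2 / ‖k‖ ^ 2) := by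
        rw [add_div, div_mul_div_comm, div_mul_div_comm]

end

open Filter Topology in
/-- continuity of the soliton map `(v,ω) ↦ (A_{v,ω}, Π_{v,ω})` into
`Ḣ¹ × L²`: if `(vₙ, ωₙ) → (v, ω)` within `{|v| < 1}`, then the `Ḣ¹` distance
`∫ |k|² |Â_{vₙ,ωₙ} − Â_{v,ω}|² dk` and the `L²` distance
`∫ |(vₙ·k)Â_{vₙ,ωₙ} − (v·k)Â_{v,ω}|² dk` tend to `0`. -/
theorem soliton_map_continuous
    (ρ : SchwartzMap V2 ℝ)
    (hrad : ∀ x y : V2, ‖x‖ = ‖y‖ → ρ x = ρ y)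
    (hneu : (∫ x : V2, ρ x) = 0)
    (v : ℕ → V2) (ω : ℕ → ℝ) (v₀ : V2) (ω₀ : ℝ)
    (hvn : ∀ n, ‖v n‖ < 1) (hv₀ : ‖v₀‖ < 1)
    (hconv : Tendsto (fun n => (v n, ω n)) atTop (𝓝 (v₀, ω₀))) :
    Tendsto (fun n => ∫ k : V2,
        ‖k‖ ^ 2 * ∑ j, ‖Ahat (⇑ρ) (v n) (ω n) j k - Ahat (⇑ρ) v₀ ω₀ j k‖ ^ 2)
      atTop (𝓝 0)
    ∧ Tendsto (fun n => ∫ k : V2,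
        ∑ j, ‖((⟪v n, k⟫ : ℝ) : ℂ) * Ahat (⇑ρ) (v n) (ω n) j k
              - ((⟪v₀, k⟫ : ℝ) : ℂ) * Ahat (⇑ρ) v₀ ω₀ j k‖ ^ 2)
      atTop (𝓝 0) := by
  have hv : Tendsto v atTop (𝓝 v₀) := (continuous_fst.tendsto _).comp hconv
  have hω : Tendsto ω atTop (𝓝 ω₀) := (continuous_snd.tendsto _).comp hconv
  obtain ⟨r, hr₀, hr⟩ := exists_between hv₀
  have hev : ∀ᶠ n in atTop, ‖v n‖ ≤ r ∧ |ω n| ≤ |ω₀| + 1 :=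
    (hv.norm.eventually_le_const hr₀).and
      (hω.abs.eventually_le_const (lt_add_one _))
  have hm : Measurable (FT ρ) := by
    obtain ⟨S, hS⟩ := exists_schwartz_eq_FT ρ
    exact hS ▸ S.continuous.measurable
  let B : V2 → ℝ := fun k =>
    (2 * ‖FT ρ k‖ + (|ω₀| + 1) * ‖fderiv ℝ (FT ρ) k‖) / ((1 - r ^ 2) * ‖k‖)
  have hB : Integrable fun k => B k ^ 2 :=
    integrable_dominating_sq ρ hrad hneu (|ω₀| + 1) (1 - r ^ 2)
  have hbd {v : V2} {ω : ℝ} (h : ‖v‖ ≤ r ∧ |ω| ≤ |ω₀| + 1) (j : Fin 2) (k : V2) :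
      ‖k‖ * ‖Ahat (⇑ρ) v ω j k‖ ≤ B k :=
    norm_mul_norm_Ahat_le (⇑ρ) hr h.1 h.2 j k
  have h₀ : ‖v₀‖ ≤ r ∧ |ω₀| ≤ |ω₀| + 1 := ⟨hr₀.le, (lt_add_one _).le⟩
  have hlim := tendsto_Ahat (⇑ρ) hv₀ hv hω
  constructor
  · have hbd₁ {v : V2} {ω : ℝ} (h : ‖v‖ ≤ r ∧ |ω| ≤ |ω₀| + 1) (j : Fin 2) (k : V2) :
        ‖((‖k‖ : ℝ) : ℂ) * Ahat (⇑ρ) v ω j k‖ ≤ B k := by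
      rw [norm_mul, Complex.norm_real, norm_norm]
      exact hbd h j k
    have hmeas (v : V2) (ω : ℝ) (j : Fin 2) :
        Measurable fun k => ((‖k‖ : ℝ) : ℂ) * Ahat (⇑ρ) v ω j k :=
      (Complex.measurable_ofReal.comp measurable_norm).mul (measurable_Ahat hm v ω j)
    have key := tendsto_integral_sum_norm_sub_sq (fun n j => hmeas (v n) (ω n) j)
      (fun j => hmeas v₀ ω₀ j) hB (hev.mono fun n hn => hbd₁ hn) (hbd₁ h₀)
      (fun j k => (hlim j k).const_mul _)
    simpa only [← mul_sub, norm_mul, Complex.norm_real, norm_norm, mul_pow, ← Finset.mul_sum]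
      using key
  · have hbd₂ {v : V2} {ω : ℝ} (h : ‖v‖ ≤ r ∧ |ω| ≤ |ω₀| + 1) (j : Fin 2) (k : V2) :
        ‖((⟪v, k⟫ : ℝ) : ℂ) * Ahat (⇑ρ) v ω j k‖ ≤ B k := by
      rw [norm_mul, Complex.norm_real, Real.norm_eq_abs]
      refine (mul_le_mul_of_nonneg_right ?_ (norm_nonneg _)).trans (hbd h j k)
      exact (abs_real_inner_le_norm v k).trans
        (mul_le_of_le_one_left (norm_nonneg _) (h.1.trans hr.le))
    have hmeas (v : V2) (ω : ℝ) (j : Fin 2) :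
        Measurable fun k => ((⟪v, k⟫ : ℝ) : ℂ) * Ahat (⇑ρ) v ω j k :=
      (Complex.measurable_ofReal.comp (by fun_prop)).mul (measurable_Ahat hm v ω j)
    refine tendsto_integral_sum_norm_sub_sq (fun n j => hmeas (v n) (ω n) j)
      (fun j => hmeas v₀ ω₀ j) hB (hev.mono fun n hn => hbd₂ hn) (hbd₂ h₀)
      (fun j k => Tendsto.mul ?_ (hlim j k))
    exact (Complex.continuous_ofReal.tendsto _).comp (hv.inner tendsto_const_nhds)

end
end
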